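/- Let d ≥ 1, α ∈ (0,2), κ₁ ≥ 1, and let κ : ℝ^d → ℝ be measurable with 1 ≤ κ(y) ≤ κ₁ for all y. Set c₀ := ∫_{|y|≥1} |y|^{−d−α} dy. Then there exists a constant C = C(d,α) > 0 such that for all z = (x,v) ∈ ℝ^d × ℝ^d, S(z) ≥ C^{-1} · e^{−c₀κ₁} · (|z|+1)^{−(d+α)} · ∫_0^1 (|x − s v| + 1)^{−(d+α)} ds. -/

import Mathlib

open MeasureTheory Real RealInnerProductSpace

/-- Total mass `λ` of the large-jump Lévy measure. -/
noncomputable def bigLam (d : ℕ) (α : ℝ) (κ : EuclideanSpace ℝ (Fin d) → ℝ) : ℝ :=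
  ∫ y in {y : EuclideanSpace ℝ (Fin d) | 1 < ‖y‖}, κ y * ‖y‖ ^ (-(d : ℝ) - α)

/-- `S(z)`: the probability that the large-jump part `Z₁^{(1)}` lies in the unit cube
`Q₁(z)`, written as an explicit series of iterated integrals. -/
noncomputable def bigS (d : ℕ) (α : ℝ) (κ : EuclideanSpace ℝ (Fin d) → ℝ)
    (x v : EuclideanSpace ℝ (Fin d)) : ℝ :=
  ∑' n : ℕ,
    (Real.exp (-(bigLam d α κ)) / (Nat.factorial (n + 1) : ℝ)) *
      ∫ s in Set.univ.pi fun _ : Fin (n + 1) => Set.Icc (0 : ℝ) 1,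
        ∫ y : Fin (n + 1) → EuclideanSpace ℝ (Fin d),
          (if ‖(∑ j, s j • y j) - x‖ ≤ 1 then (1 : ℝ) else 0) *
            (if ‖(∑ j, y j) - v‖ ≤ 1 then (1 : ℝ) else 0) *
            ∏ j, (if 1 < ‖y j‖ then κ (y j) * ‖y j‖ ^ (-(d : ℝ) - α) else 0)

/-- The density of the large-jump Lévy measure. -/
noncomputable def jumpDensity (d : ℕ) (α : ℝ) (κ : EuclideanSpace ℝ (Fin d) → ℝ)
    (y : EuclideanSpace ℝ (Fin d)) : ℝ :=
  if 1 < ‖y‖ then κ y * ‖y‖ ^ (-(d : ℝ) - α) else 0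

/-- The integrand in the definition of `bigS`. -/
noncomputable def jumpIntegrand (d : ℕ) (α : ℝ) (κ : EuclideanSpace ℝ (Fin d) → ℝ)
    (x v : EuclideanSpace ℝ (Fin d)) {n : ℕ} (s : Fin n → ℝ)
    (y : Fin n → EuclideanSpace ℝ (Fin d)) : ℝ :=
  (if ‖(∑ j, s j • y j) - x‖ ≤ 1 then (1 : ℝ) else 0) *
    (if ‖(∑ j, y j) - v‖ ≤ 1 then (1 : ℝ) else 0) * ∏ j, jumpDensity d α κ (y j)

lemma bigS_eq (d : ℕ) (α : ℝ) (κ : EuclideanSpace ℝ (Fin d) → ℝ)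
    (x v : EuclideanSpace ℝ (Fin d)) :
    bigS d α κ x v = ∑' n : ℕ,
      (Real.exp (-(bigLam d α κ)) / (Nat.factorial (n + 1) : ℝ)) *
        ∫ s in Set.univ.pi fun _ : Fin (n + 1) => Set.Icc (0 : ℝ) 1,
          ∫ y, jumpIntegrand d α κ x v s y := rfl

lemma integrableOn_norm_rpow (d : ℕ) {α : ℝ} (hα : 0 < α) :
    IntegrableOn (fun y : EuclideanSpace ℝ (Fin d) => ‖y‖ ^ (-(d : ℝ) - α)) {y | 1 ≤ ‖y‖} := by
  have h := integrable_one_add_norm (E := EuclideanSpace ℝ (Fin d)) (μ := volume)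
    (r := d + α) (by simp [hα])
  have hm : MeasurableSet {y : EuclideanSpace ℝ (Fin d) | 1 ≤ ‖y‖} :=
    measurableSet_le measurable_const measurable_norm
  refine ((h.const_mul (2 ^ ((d : ℝ) + α))).integrableOn (s := {y | 1 ≤ ‖y‖})).mono'
    (Measurable.aestronglyMeasurable (by measurability)) ?_
  refine (ae_restrict_iff' hm).2 (Filter.Eventually.of_forall fun y hy => ?_)
  have hy : 1 ≤ ‖y‖ := hy
  have h0 : 0 < ‖y‖ := by linarith
  have h1 : (0 : ℝ) ≤ d + α := by positivity
  rw [Real.norm_of_nonneg (by positivity), show -(d : ℝ) - α = -(d + α) by ring,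
    Real.rpow_neg h0.le, Real.rpow_neg (by positivity), ← div_eq_mul_inv,
    inv_eq_one_div, div_le_div_iff₀ (by positivity) (by positivity), one_mul,
    ← Real.mul_rpow (by norm_num) h0.le]
  exact Real.rpow_le_rpow (by positivity) (by linarith) h1

section JumpDensity

variable {d : ℕ} {α κ₁ : ℝ} {κ : EuclideanSpace ℝ (Fin d) → ℝ}

lemma jumpDensity_nonneg (hκ : ∀ y, 1 ≤ κ y) (y : EuclideanSpace ℝ (Fin d)) :
    0 ≤ jumpDensity d α κ y := by
  unfold jumpDensity
  split_ifs
  · have := hκ y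
    positivity
  · exact le_rfl

lemma measurable_jumpDensity (hm : Measurable κ) : Measurable (jumpDensity d α κ) := by
  unfold jumpDensity
  exact Measurable.ite (measurableSet_lt measurable_const measurable_norm)
    (by fun_prop) measurable_const

lemma jumpDensity_le (hκ : ∀ y, 1 ≤ κ y ∧ κ y ≤ κ₁) (y : EuclideanSpace ℝ (Fin d)) :
    jumpDensity d α κ y ≤
      Set.indicator {y | 1 ≤ ‖y‖} (fun y => κ₁ * ‖y‖ ^ (-(d : ℝ) - α)) y := by
  have h1 := hκ y
  unfold jumpDensity
  by_cases h : 1 < ‖y‖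
  · rw [if_pos h, Set.indicator_of_mem (by exact h.le)]
    gcongr
    exact h1.2
  · rw [if_neg h]
    refine Set.indicator_nonneg (fun y _ => ?_) y
    have := (hκ y).1.trans (hκ y).2
    positivity

lemma integrable_jumpDensity (hα : 0 < α) (hm : Measurable κ) (hκ : ∀ y, 1 ≤ κ y ∧ κ y ≤ κ₁) :
    Integrable (jumpDensity d α κ) := by
  have hs : MeasurableSet {y : EuclideanSpace ℝ (Fin d) | 1 ≤ ‖y‖} :=
    measurableSet_le measurable_const measurable_norm
  refine (IntegrableOn.integrable_indicator ((integrableOn_norm_rpow d hα).const_mul κ₁) hs).mono'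
    (measurable_jumpDensity hm).aestronglyMeasurable (Filter.Eventually.of_forall fun y => ?_)
  rw [Real.norm_of_nonneg (jumpDensity_nonneg (fun y => (hκ y).1) y)]
  exact jumpDensity_le hκ y

lemma bigLam_eq_integral_jumpDensity : bigLam d α κ = ∫ y, jumpDensity d α κ y := by
  have hs : MeasurableSet {y : EuclideanSpace ℝ (Fin d) | 1 < ‖y‖} :=
    measurableSet_lt measurable_const measurable_norm
  rw [bigLam, ← integral_indicator hs]
  rfl

lemma bigLam_le (hα : 0 < α) (hm : Measurable κ) (hκ : ∀ y, 1 ≤ κ y ∧ κ y ≤ κ₁) :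
    bigLam d α κ ≤
      (∫ y in {y : EuclideanSpace ℝ (Fin d) | 1 ≤ ‖y‖}, ‖y‖ ^ (-(d : ℝ) - α)) * κ₁ := by
  have hs : MeasurableSet {y : EuclideanSpace ℝ (Fin d) | 1 ≤ ‖y‖} :=
    measurableSet_le measurable_const measurable_norm
  rw [bigLam_eq_integral_jumpDensity, mul_comm, ← integral_const_mul, ← integral_indicator hs]
  exact integral_mono (integrable_jumpDensity hα hm hκ)
    (IntegrableOn.integrable_indicator ((integrableOn_norm_rpow d hα).const_mul κ₁) hs) (jumpDensity_le hκ)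

lemma jumpIntegrand_nonneg (hκ : ∀ y, 1 ≤ κ y) (x v : EuclideanSpace ℝ (Fin d)) {n : ℕ}
    (s : Fin n → ℝ) (y : Fin n → EuclideanSpace ℝ (Fin d)) :
    0 ≤ jumpIntegrand d α κ x v s y := by
  have := Finset.prod_nonneg fun j (_ : j ∈ Finset.univ) => jumpDensity_nonneg (α := α) hκ (y j)
  unfold jumpIntegrand
  positivity

lemma jumpIntegrand_le (hκ : ∀ y, 1 ≤ κ y) (x v : EuclideanSpace ℝ (Fin d)) {n : ℕ}
    (s : Fin n → ℝ) (y : Fin n → EuclideanSpace ℝ (Fin d)) :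
    jumpIntegrand d α κ x v s y ≤ ∏ j, jumpDensity d α κ (y j) := by
  have := Finset.prod_nonneg fun j (_ : j ∈ Finset.univ) => jumpDensity_nonneg (α := α) hκ (y j)
  unfold jumpIntegrand
  split_ifs <;> simp [this]

lemma measurable_jumpIntegrand (hm : Measurable κ) (x v : EuclideanSpace ℝ (Fin d)) {n : ℕ} :
    Measurable fun p : (Fin n → ℝ) × (Fin n → EuclideanSpace ℝ (Fin d)) =>
      jumpIntegrand d α κ x v p.1 p.2 := by
  have := measurable_jumpDensity (α := α) hm
  unfold jumpIntegrand
  refine ((Measurable.ite (measurableSet_le (by fun_prop) measurable_const)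
    measurable_const measurable_const).mul (Measurable.ite
      (measurableSet_le (by fun_prop) measurable_const) measurable_const measurable_const)).mul
    (by fun_prop)

lemma integrable_jumpIntegrand (hα : 0 < α) (hm : Measurable κ)
    (hκ : ∀ y, 1 ≤ κ y ∧ κ y ≤ κ₁) (x v : EuclideanSpace ℝ (Fin d)) {n : ℕ} (s : Fin n → ℝ) :
    Integrable fun y => jumpIntegrand d α κ x v s y := by
  have hκ' := fun y => (hκ y).1
  refine (Integrable.fintype_prod (ι := Fin n) (fun _ => integrable_jumpDensity hα hm hκ)).mono'
    ((measurable_jumpIntegrand hm x v).comp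
      (measurable_const.prodMk measurable_id)).aestronglyMeasurable
    (Filter.Eventually.of_forall fun y => ?_)
  rw [Real.norm_of_nonneg (jumpIntegrand_nonneg hκ' x v s y)]
  exact jumpIntegrand_le hκ' x v s y

lemma norm_integral_jumpIntegrand_le (hα : 0 < α) (hm : Measurable κ)
    (hκ : ∀ y, 1 ≤ κ y ∧ κ y ≤ κ₁) (x v : EuclideanSpace ℝ (Fin d)) {n : ℕ} (s : Fin n → ℝ) :
    ‖∫ y, jumpIntegrand d α κ x v s y‖ ≤ bigLam d α κ ^ n := by
  have hκ' := fun y => (hκ y).1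
  rw [Real.norm_of_nonneg (integral_nonneg fun y => jumpIntegrand_nonneg hκ' x v s y),
    bigLam_eq_integral_jumpDensity]
  refine (integral_mono (integrable_jumpIntegrand hα hm hκ x v s)
    (Integrable.fintype_prod (ι := Fin n) (fun _ => integrable_jumpDensity hα hm hκ))
    (jumpIntegrand_le hκ' x v s)).trans ?_
  rw [integral_fintype_prod_volume_eq_pow, Fintype.card_fin]

lemma volume_unit_cube (n : ℕ) :
    volume (Set.univ.pi fun _ : Fin n => Set.Icc (0 : ℝ) 1) = 1 := by
  rw [volume_pi_pi]
  simp

lemma integrableOn_integral_jumpIntegrand (hα : 0 < α) (hm : Measurable κ)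
    (hκ : ∀ y, 1 ≤ κ y ∧ κ y ≤ κ₁) (x v : EuclideanSpace ℝ (Fin d)) (n : ℕ) :
    IntegrableOn (fun s : Fin n → ℝ => ∫ y, jumpIntegrand d α κ x v s y)
      (Set.univ.pi fun _ => Set.Icc (0 : ℝ) 1) :=
  Measure.integrableOn_of_bounded (by rw [volume_unit_cube]; exact ENNReal.one_ne_top)
    (measurable_jumpIntegrand hm x v).stronglyMeasurable.integral_prod_right'.aestronglyMeasurable
    (Filter.Eventually.of_forall fun s => norm_integral_jumpIntegrand_le hα hm hκ x v s)

lemma term_le_bigS (hα : 0 < α) (hm : Measurable κ)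
    (hκ : ∀ y, 1 ≤ κ y ∧ κ y ≤ κ₁) (x v : EuclideanSpace ℝ (Fin d)) (n : ℕ) :
    (Real.exp (-(bigLam d α κ)) / (Nat.factorial (n + 1) : ℝ)) *
        ∫ s in Set.univ.pi fun _ : Fin (n + 1) => Set.Icc (0 : ℝ) 1,
          ∫ y, jumpIntegrand d α κ x v s y ≤ bigS d α κ x v := by
  have h0 : ∀ n : ℕ, 0 ≤ (Real.exp (-(bigLam d α κ)) / (Nat.factorial (n + 1) : ℝ)) *
        ∫ s in Set.univ.pi fun _ : Fin (n + 1) => Set.Icc (0 : ℝ) 1,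
          ∫ y, jumpIntegrand d α κ x v s y := fun n =>
    mul_nonneg (by positivity) (integral_nonneg fun s => integral_nonneg fun y =>
      jumpIntegrand_nonneg (fun y => (hκ y).1) x v s y)
  rw [bigS_eq]
  refine Summable.le_tsum (Summable.of_nonneg_of_le h0 (fun n => ?_)
    (((summable_nat_add_iff 1).2 (Real.summable_pow_div_factorial (bigLam d α κ))).mul_left
      (Real.exp (-(bigLam d α κ))))) n (fun j _ => h0 j)
  rw [div_mul_eq_mul_div, mul_div_assoc]
  have h := norm_setIntegral_le_of_norm_le_const
    (s := Set.univ.pi fun _ : Fin (n + 1) => Set.Icc (0 : ℝ) 1)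
    (μ := volume) (by rw [volume_unit_cube]; exact ENNReal.one_lt_top)
    (fun s _ => norm_integral_jumpIntegrand_le hα hm hκ x v s)
  rw [measureReal_def, volume_unit_cube, ENNReal.toReal_one, mul_one] at h
  gcongr
  exact (Real.le_norm_self _).trans h

end JumpDensity

/-- Among three points at mutual distance at least `4` on a line, one avoids two given open balls
of radius `2`. -/
lemma exists_norm_ge_two_of_near {E : Type*} [NormedAddCommGroup E] [NormedSpace ℝ E]
    {e : E} (he : ‖e‖ = 4) (u v : E) : ∃ q : E, ‖q - u‖ ≤ 4 ∧ 2 ≤ ‖q‖ ∧ 2 ≤ ‖v - q‖ := by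
  have h1 : ∀ w, ‖u - w‖ < 2 → ‖u + e - w‖ < 2 → False := fun w ha hb => by
    have := norm_sub_le (u + e - w) (u - w)
    rw [show u + e - w - (u - w) = e by abel] at this
    linarith
  have h2 : ∀ w, ‖u - w‖ < 2 → ‖u - e - w‖ < 2 → False := fun w ha hb => by
    have := norm_sub_le (u - w) (u - e - w)
    rw [show u - w - (u - e - w) = e by abel] at this
    linarith
  have h3 : ∀ w, ‖u + e - w‖ < 2 → ‖u - e - w‖ < 2 → False := fun w ha hb => by
    have := norm_sub_le (u + e - w) (u - e - w)
    rw [show u + e - w - (u - e - w) = (2 : ℝ) • e by rw [two_smul]; abel, norm_smul, he] at this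
    norm_num at this
    linarith
  by_contra! H
  have a1 := H u (by simp)
  have a2 := H (u + e) (by simp [he])
  have a3 := H (u - e) (by simp [he])
  have b1 := h1 0
  have b2 := h2 0
  have b3 := h3 0
  have c1 := h1 v
  have c2 := h2 v
  have c3 := h3 v
  simp only [sub_zero] at b1 b2 b3
  rw [norm_sub_rev v] at a1 a2 a3
  grind

section LowerBound

variable {d : ℕ} {α κ₁ : ℝ} {κ : EuclideanSpace ℝ (Fin d) → ℝ}

lemma rpow_le_jumpDensity (hα : 0 < α) (hκ : ∀ y, 1 ≤ κ y) {y : EuclideanSpace ℝ (Fin d)} {R : ℝ}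
    (h1 : 1 < ‖y‖) (hR : ‖y‖ ≤ R) : R ^ (-((d : ℝ) + α)) ≤ jumpDensity d α κ y := by
  have h0 : 0 < ‖y‖ := by linarith
  rw [jumpDensity, if_pos h1, show -(d : ℝ) - α = -(d + α) by ring]
  have h : R ^ (-((d : ℝ) + α)) ≤ ‖y‖ ^ (-((d : ℝ) + α)) :=
    Real.rpow_le_rpow_of_nonpos h0 hR (neg_nonpos.2 (by positivity))
  exact h.trans (le_mul_of_one_le_left (by positivity) (hκ y))

lemma jumpIntegrand_two_ge (hα : 0 < α) (hκ : ∀ y, 1 ≤ κ y) {x v q : EuclideanSpace ℝ (Fin d)}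
    {s t : ℝ} (hs : s ∈ Set.Icc (0 : ℝ) 1) (ha : 1 / 20 ≤ |t - s|)
    (hb : |t - s| ≤ 1 / 10) (hqu : ‖q - (t - s)⁻¹ • (x - s • v)‖ ≤ 4) (hq : 2 ≤ ‖q‖)
    (hvq : 2 ≤ ‖v - q‖) {y₀ y₁ : EuclideanSpace ℝ (Fin d)} (h₀ : ‖y₀ - (v - q)‖ < 1 / 8)
    (h₁ : ‖y₁ - q‖ < 1 / 8) :
    (41 * (√(‖x‖ ^ 2 + ‖v‖ ^ 2) + 1)) ^ (-((d : ℝ) + α)) *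
      (20 * (‖x - s • v‖ + 1)) ^ (-((d : ℝ) + α)) ≤
    jumpIntegrand d α κ x v ![s, t] ![y₀, y₁] := by
  set r := t - s with hr
  set p := x - s • v with hp
  have hr0 : r ≠ 0 := by
    rintro h
    rw [h, abs_zero] at ha
    norm_num at ha
  set u := r⁻¹ • p with hu
  have hru : r • u = p := by rw [hu, smul_smul, mul_inv_cancel₀ hr0, one_smul]
  have hun : ‖u‖ ≤ 20 * ‖p‖ := by
    rw [hu, norm_smul, norm_inv, Real.norm_eq_abs]
    gcongr
    rw [inv_le_comm₀ (by linarith) (by norm_num)]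
    linarith
  have hxn : ‖x‖ ≤ √(‖x‖ ^ 2 + ‖v‖ ^ 2) := Real.le_sqrt_of_sq_le (by nlinarith [sq_nonneg ‖v‖])
  have hvn : ‖v‖ ≤ √(‖x‖ ^ 2 + ‖v‖ ^ 2) := Real.le_sqrt_of_sq_le (by nlinarith [sq_nonneg ‖x‖])
  have hpn : ‖p‖ ≤ ‖x‖ + ‖v‖ := by
    refine (norm_sub_le _ _).trans ?_
    rw [norm_smul, Real.norm_of_nonneg hs.1]
    have := mul_le_of_le_one_left (norm_nonneg v) hs.2
    linarith
  have hqn : ‖q‖ ≤ 20 * ‖p‖ + 4 := by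
    have := norm_add_le (q - u) u
    rw [sub_add_cancel] at this
    linarith
  have hy₁ : ‖y₁‖ ≤ ‖q‖ + 1 / 8 := by
    have := norm_add_le (y₁ - q) q
    rw [sub_add_cancel] at this
    linarith
  have hy₁' : ‖q‖ - 1 / 8 ≤ ‖y₁‖ := by
    have := norm_sub_le y₁ (y₁ - q)
    rw [sub_sub_cancel] at this
    linarith
  have hy₀ : ‖y₀‖ ≤ ‖v - q‖ + 1 / 8 := by
    have := norm_add_le (y₀ - (v - q)) (v - q)
    rw [sub_add_cancel] at this
    linarith
  have hy₀' : ‖v - q‖ - 1 / 8 ≤ ‖y₀‖ := by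
    have := norm_sub_le y₀ (y₀ - (v - q))
    rw [sub_sub_cancel] at this
    linarith
  have hvq' := norm_sub_le v q
  have hsum : ‖y₀ + y₁ - v‖ ≤ 1 / 4 := by
    rw [show y₀ + y₁ - v = (y₀ - (v - q)) + (y₁ - q) by abel]
    exact (norm_add_le _ _).trans (by linarith)
  have hpos : ‖s • y₀ + t • y₁ - x‖ ≤ 1 := by
    have e : s • y₀ + t • y₁ - x = s • (y₀ + y₁ - v) + r • ((y₁ - q) + (q - u)) := by
      have : x = r • u + s • v := by rw [hru, hp]; abel
      rw [this, show t = r + s by rw [hr]; ring]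
      module
    have e1 : ‖s • (y₀ + y₁ - v)‖ ≤ 1 / 4 := by
      rw [norm_smul, Real.norm_of_nonneg hs.1]
      exact (mul_le_of_le_one_left (norm_nonneg _) hs.2).trans hsum
    have e2 : ‖r • ((y₁ - q) + (q - u))‖ ≤ 1 / 10 * 5 := by
      rw [norm_smul, Real.norm_eq_abs]
      have := norm_add_le (y₁ - q) (q - u)
      gcongr
      linarith
    rw [e]
    exact (norm_add_le _ _).trans (by linarith)
  have d₀ := rpow_le_jumpDensity hα hκ (y := y₀) (R := 41 * (√(‖x‖ ^ 2 + ‖v‖ ^ 2) + 1))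
    (by linarith) (by linarith)
  have d₁ := rpow_le_jumpDensity hα hκ (y := y₁) (R := 20 * (‖p‖ + 1))
    (by linarith) (by linarith)
  simp only [jumpIntegrand, Fin.sum_univ_two, Fin.prod_univ_two, Matrix.cons_val_zero,
    Matrix.cons_val_one]
  rw [if_pos hpos, if_pos (by linarith), one_mul, one_mul]
  gcongr
  exact jumpDensity_nonneg hκ _

lemma integral_jumpIntegrand_two_ge (hd : 1 ≤ d) (hα : 0 < α) (hm : Measurable κ)
    (hκ : ∀ y, 1 ≤ κ y ∧ κ y ≤ κ₁) (x v : EuclideanSpace ℝ (Fin d)) {s t : ℝ}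
    (hs : s ∈ Set.Icc (0 : ℝ) 1) (ha : 1 / 20 ≤ |t - s|) (hb : |t - s| ≤ 1 / 10) :
    (41 * (√(‖x‖ ^ 2 + ‖v‖ ^ 2) + 1)) ^ (-((d : ℝ) + α)) *
      (20 * (‖x - s • v‖ + 1)) ^ (-((d : ℝ) + α)) *
      volume.real (Metric.ball (0 : EuclideanSpace ℝ (Fin d)) (1 / 8)) ^ 2 ≤
    ∫ y, jumpIntegrand d α κ x v ![s, t] y := by
  have : Nonempty (Fin d) := ⟨⟨0, hd⟩⟩
  obtain ⟨e, he⟩ := exists_norm_eq (EuclideanSpace ℝ (Fin d)) (c := 4) (by norm_num)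
  obtain ⟨q, hqu, hq, hvq⟩ := exists_norm_ge_two_of_near he ((t - s)⁻¹ • (x - s • v)) v
  let A : Set (Fin 2 → EuclideanSpace ℝ (Fin d)) :=
    Set.univ.pi fun j => Metric.ball (![v - q, q] j) (1 / 8)
  have hA : volume A = volume (Metric.ball (0 : EuclideanSpace ℝ (Fin d)) (1 / 8)) ^ 2 := by
    simp_rw [A, volume_pi_pi, Measure.addHaar_ball_center]
    simp
  have hAm : MeasurableSet A := MeasurableSet.univ_pi fun _ => measurableSet_ball
  have hI := integrable_jumpIntegrand hα hm hκ x v ![s, t]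
  refine le_trans ?_ (setIntegral_le_integral (s := A) hI
    (Filter.Eventually.of_forall fun y => jumpIntegrand_nonneg (fun y => (hκ y).1) x v _ y))
  have hreal : volume.real A =
      volume.real (Metric.ball (0 : EuclideanSpace ℝ (Fin d)) (1 / 8)) ^ 2 := by
    rw [measureReal_def, hA, ENNReal.toReal_pow, measureReal_def]
  rw [← hreal]
  refine setIntegral_ge_of_const_le_real hAm ?_ (fun y hy => ?_) hI.integrableOn
  · rw [hA]
    exact (ENNReal.pow_lt_top measure_ball_lt_top).ne
  · have h₀ : ‖y 0 - (v - q)‖ < 1 / 8 := by simpa [dist_eq_norm] using hy 0 (Set.mem_univ _)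
    have h₁ : ‖y 1 - q‖ < 1 / 8 := by simpa [dist_eq_norm] using hy 1 (Set.mem_univ _)
    have hy' : y = ![y 0, y 1] := by
      ext j
      fin_cases j <;> rfl
    rw [hy']
    exact jumpIntegrand_two_ge hα (fun y => (hκ y).1) hs ha hb hqu hq hvq h₀ h₁

lemma volume_near_ge {s : ℝ} (hs : s ∈ Set.Icc (0 : ℝ) 1) :
    1 / 20 ≤ volume.real {t : ℝ | t ∈ Set.Icc (0 : ℝ) 1 ∧ 1 / 20 ≤ |t - s| ∧ |t - s| ≤ 1 / 10} := by
  have hfin : volume {t : ℝ | t ∈ Set.Icc (0 : ℝ) 1 ∧ 1 / 20 ≤ |t - s| ∧ |t - s| ≤ 1 / 10} ≠ ⊤ :=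
    by
    have hsub : {t : ℝ | t ∈ Set.Icc (0 : ℝ) 1 ∧ 1 / 20 ≤ |t - s| ∧ |t - s| ≤ 1 / 10} ⊆
      Set.Icc 0 1 := fun t ht => ht.1
    exact measure_ne_top_of_subset hsub measure_Icc_lt_top.ne
  rcases le_total s (1 / 2) with h | h
  · calc (1 / 20 : ℝ) = volume.real (Set.Icc (s + 1 / 20) (s + 1 / 10)) := by
          rw [Real.volume_real_Icc_of_le (by linarith)]; ring
      _ ≤ _ := measureReal_mono (fun t ht => ?_) hfin
    have h1 := ht.1
    have h2 := ht.2
    have h3 := hs.1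
    refine ⟨⟨by linarith, by linarith⟩, ?_⟩
    rw [abs_of_nonneg (by linarith)]
    constructor <;> linarith
  · calc (1 / 20 : ℝ) = volume.real (Set.Icc (s - 1 / 10) (s - 1 / 20)) := by
          rw [Real.volume_real_Icc_of_le (by linarith)]; ring
      _ ≤ _ := measureReal_mono (fun t ht => ?_) hfin
    have h1 := ht.1
    have h2 := ht.2
    have h3 := hs.2
    refine ⟨⟨by linarith, by linarith⟩, ?_⟩
    rw [abs_of_nonpos (by linarith)]
    constructor <;> linarith

lemma setIntegral_finTwo_eq (F : (Fin 2 → ℝ) → ℝ)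
    (hF : IntegrableOn F (Set.univ.pi fun _ => Set.Icc (0 : ℝ) 1)) :
    ∫ s in Set.univ.pi fun _ : Fin 2 => Set.Icc (0 : ℝ) 1, F s =
      ∫ s in Set.Icc (0 : ℝ) 1, ∫ t in Set.Icc (0 : ℝ) 1, F ![s, t] ∧
    IntegrableOn (fun s => ∫ t in Set.Icc (0 : ℝ) 1, F ![s, t]) (Set.Icc (0 : ℝ) 1) ∧
    ∀ᵐ s ∂(volume.restrict (Set.Icc (0 : ℝ) 1)),
      IntegrableOn (fun t => F ![s, t]) (Set.Icc (0 : ℝ) 1) := by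
  have hmp := (volume_preserving_finTwoArrow ℝ).symm
  have hpre : (MeasurableEquiv.finTwoArrow (α := ℝ)).symm ⁻¹'
      (Set.univ.pi fun _ => Set.Icc (0 : ℝ) 1) = Set.Icc (0 : ℝ) 1 ×ˢ Set.Icc (0 : ℝ) 1 := by
    ext p
    rw [Set.mem_preimage, Set.mem_univ_pi, Fin.forall_fin_two]
    rfl
  have hemb := (MeasurableEquiv.finTwoArrow (α := ℝ)).symm.measurableEmbedding
  have h1 := hmp.setIntegral_preimage_emb hemb F (Set.univ.pi fun _ => Set.Icc (0 : ℝ) 1)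
  have h2 := (hmp.integrableOn_comp_preimage hemb).2 hF
  rw [hpre] at h1 h2
  have h3 : Integrable (F ∘ (MeasurableEquiv.finTwoArrow (α := ℝ)).symm)
      ((volume.restrict (Set.Icc (0 : ℝ) 1)).prod (volume.restrict (Set.Icc (0 : ℝ) 1))) := by
    rw [Measure.prod_restrict]
    exact h2
  refine ⟨?_, h3.integral_prod_left, h3.prod_right_ae⟩
  rw [← h1]
  exact setIntegral_prod _ h2

lemma setIntegral_integral_jumpIntegrand_ge (hd : 1 ≤ d) (hα : 0 < α) (hm : Measurable κ)
    (hκ : ∀ y, 1 ≤ κ y ∧ κ y ≤ κ₁) (x v : EuclideanSpace ℝ (Fin d)) :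
    (41 * (√(‖x‖ ^ 2 + ‖v‖ ^ 2) + 1)) ^ (-((d : ℝ) + α)) *
      volume.real (Metric.ball (0 : EuclideanSpace ℝ (Fin d)) (1 / 8)) ^ 2 * (1 / 20) *
      ∫ s in (0 : ℝ)..1, (20 * (‖x - s • v‖ + 1)) ^ (-((d : ℝ) + α)) ≤
    ∫ s in Set.univ.pi fun _ : Fin 2 => Set.Icc (0 : ℝ) 1,
      ∫ y, jumpIntegrand d α κ x v s y := by
  have hκ' := fun y => (hκ y).1
  obtain ⟨h1, h2, h3⟩ :=
    setIntegral_finTwo_eq _ (integrableOn_integral_jumpIntegrand hα hm hκ x v 2)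
  rw [h1, intervalIntegral.integral_of_le zero_le_one, ← integral_Icc_eq_integral_Ioc,
    ← integral_const_mul]
  have hpos : ∀ s : ℝ, 0 < 20 * (‖x - s • v‖ + 1) := fun s => by positivity
  refine integral_mono_ae ?_ h2 ?_
  · refine (ContinuousOn.integrableOn_Icc ?_)
    refine continuousOn_const.mul (Continuous.continuousOn ?_)
    exact Continuous.rpow_const (by fun_prop) fun s => Or.inl (hpos s).ne'
  filter_upwards [h3, ae_restrict_mem measurableSet_Icc] with s hint hs
  let T : Set ℝ := {t : ℝ | t ∈ Set.Icc (0 : ℝ) 1 ∧ 1 / 20 ≤ |t - s| ∧ |t - s| ≤ 1 / 10}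
  have hT : MeasurableSet T := by
    have hf : Measurable fun t : ℝ => |t - s| := by fun_prop
    exact measurableSet_Icc.inter
      ((measurableSet_le measurable_const hf).inter (measurableSet_le hf measurable_const))
  have hTs : T ⊆ Set.Icc 0 1 := fun t ht => ht.1
  have key := setIntegral_ge_of_const_le_real (μ := volume) hT
    (measure_ne_top_of_subset hTs measure_Icc_lt_top.ne)
    (fun t ht => integral_jumpIntegrand_two_ge hd hα hm hκ x v hs ht.2.1 ht.2.2)
    (hint.mono_set hTs)
  refine le_trans ?_ (key.trans (setIntegral_mono_set hint
    (Filter.Eventually.of_forall fun t => integral_nonneg fun y =>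
      jumpIntegrand_nonneg hκ' x v _ y) (Filter.Eventually.of_forall hTs)))
  refine le_trans (le_of_eq ?_) (mul_le_mul_of_nonneg_left (volume_near_ge hs) (by positivity))
  ring

end LowerBound

/-- lower bound for the large-jump probability `S(z)`, with
`c₀ = ∫_{|y|≥1} |y|^{−d−α} dy`. -/
theorem stmt_14 (d : ℕ) (hd : 1 ≤ d) (α : ℝ) (hα : α ∈ Set.Ioo (0 : ℝ) 2) :
    ∃ C > (0 : ℝ), ∀ (κ : EuclideanSpace ℝ (Fin d) → ℝ) (κ₁ : ℝ), 1 ≤ κ₁ →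
      Measurable κ → (∀ y, 1 ≤ κ y ∧ κ y ≤ κ₁) →
      ∀ x v : EuclideanSpace ℝ (Fin d),
        C⁻¹ * Real.exp (-(∫ y in {y : EuclideanSpace ℝ (Fin d) | 1 ≤ ‖y‖},
              ‖y‖ ^ (-(d : ℝ) - α)) * κ₁) *
            (Real.sqrt (‖x‖ ^ 2 + ‖v‖ ^ 2) + 1) ^ (-((d : ℝ) + α)) *
            (∫ s in (0 : ℝ)..1, (‖x - s • v‖ + 1) ^ (-((d : ℝ) + α))) ≤
          bigS d α κ x v := by
  have hα0 := hα.1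
  have hm : 0 < volume.real (Metric.ball (0 : EuclideanSpace ℝ (Fin d)) (1 / 8)) :=
    ENNReal.toReal_pos (Metric.measure_ball_pos _ _ (by norm_num)).ne' measure_ball_lt_top.ne
  refine ⟨((1 / 2) * (41 ^ (-((d : ℝ) + α)) * 20 ^ (-((d : ℝ) + α)) *
    volume.real (Metric.ball (0 : EuclideanSpace ℝ (Fin d)) (1 / 8)) ^ 2 * (1 / 20)))⁻¹,
    by positivity, fun κ κ₁ _ hκm hκ x v => ?_⟩
  have hint := setIntegral_integral_jumpIntegrand_ge hd hα0 hκm hκ x v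
  have hsplit : ∀ s : ℝ, (20 * (‖x - s • v‖ + 1)) ^ (-((d : ℝ) + α)) =
      20 ^ (-((d : ℝ) + α)) * (‖x - s • v‖ + 1) ^ (-((d : ℝ) + α)) := fun s =>
    Real.mul_rpow (by norm_num) (by positivity)
  simp only [hsplit] at hint
  rw [intervalIntegral.integral_const_mul, Real.mul_rpow (by norm_num) (by positivity)] at hint
  have hI : 0 ≤ ∫ s in (0 : ℝ)..1, (‖x - s • v‖ + 1) ^ (-((d : ℝ) + α)) :=
    intervalIntegral.integral_nonneg zero_le_one fun s _ => by positivity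
  have hexp : Real.exp (-(∫ y in {y : EuclideanSpace ℝ (Fin d) | 1 ≤ ‖y‖},
      ‖y‖ ^ (-(d : ℝ) - α)) * κ₁) ≤ Real.exp (-(bigLam d α κ)) := by
    rw [neg_mul]
    exact Real.exp_le_exp.2 (neg_le_neg (bigLam_le hα0 hκm hκ))
  refine le_trans ?_ (term_le_bigS hα0 hκm hκ x v 1)
  refine le_trans (le_of_eq ?_) (mul_le_mul (div_le_div_of_nonneg_right hexp (by positivity))
    hint (by positivity) (by positivity))
  rw [inv_inv, show (((1 + 1 : ℕ).factorial : ℕ) : ℝ) = 2 by norm_num [Nat.factorial]]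
  ring
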